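/- arXiv:2010.03056 — 4 statements merged into one kernel-verified Lean document; each statement's English description precedes it below -/
import Mathlib

section
/- Let n ≥ 2, Λ ≥ 1, C_A > 0 and α ∈ (0,1]. Let φ: ℝⁿ → ℝ be a Lipschitz function with φ(0) = 0 and Lipschitz constant γ ≤ 1/(50n). Let A: ℝ^{n+1} → ℝ^{(n+1)×(n+1)} be a Λ-elliptic matrix-valued function satisfying the Hölder condition |A(X) − A(Y)| ≤ C_A|X − Y|^α for all X, Y ∈ ℝ^{n+1}. For τ > 0 let Q_τ = {x ∈ ℝⁿ : |x|_∞ < τ} and define A_{τ,φ}(x,t) := A(0) if x ∉ Q_τ; A_{τ,φ}(x,t) := A(x,t) if (x,t) ∈ R_{Q_τ,φ}; and A_{τ,φ}(x,t) := A(x,φ(x)) otherwise. Set A₁(x) := A(x,φ(x))·𝟙_{Q_τ}(x) + A(0)·(1 − 𝟙_{Q_τ}(x)) and B(x,t) := A_{τ,φ}(x,t) − A₁(x). Then there exists a constant C₁ depending only on C_A, n and α such that ‖A₁ − A(0)‖_{L^∞(ℝⁿ)} + ‖B‖_{𝒞_φ} ≤ C₁ τ^α. -/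
open scoped BigOperators ENNReal
open Matrix MeasureTheory

/-- The operator norm of a square matrix induced by the Euclidean (`ℓ²`) norm on `ℝ^m`. -/
noncomputable def eopNorm {m : ℕ} (M : Matrix (Fin m) (Fin m) ℝ) : ℝ :=
  ‖LinearMap.toContinuousLinearMap (Matrix.toEuclideanLin M)‖

/-- Euclidean distance between two points of `ℝⁿ`. -/
noncomputable def l2dist {n : ℕ} (x y : Fin n → ℝ) : ℝ :=
  Real.sqrt (∑ i, (x i - y i) ^ 2)

/-- Euclidean norm of a point `X = (x,t)` of `ℝ^{n+1} = ℝⁿ × ℝ`. -/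
noncomputable def enorm2 {n : ℕ} (X : (Fin n → ℝ) × ℝ) : ℝ :=
  Real.sqrt ((∑ i, X.1 i ^ 2) + X.2 ^ 2)

/-- The `φ`-adapted Carleson box `R_{Q,φ}` over the cube `Q` with center `y₀` and
half side length `r` (so `ℓ(Q) = 2r`); `‖·‖` on `Fin n → ℝ` is the `ℓ^∞` norm. -/
def RboxPhi (n : ℕ) (φ : (Fin n → ℝ) → ℝ) (y₀ : Fin n → ℝ) (r : ℝ) :
    Set ((Fin n → ℝ) × ℝ) :=
  {p | ‖p.1 - y₀‖ < r ∧ φ p.1 < p.2 ∧ p.2 < φ p.1 + 2 * r}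

/-- The `φ`-adapted Whitney region `W_φ(X)` of a point `X = (x, φ(x) + t)`,
where `t = X.2 - φ(X.1)`. -/
noncomputable def WphiRegion (n : ℕ) (φ : (Fin n → ℝ) → ℝ) (X : (Fin n → ℝ) × ℝ) :
    Set ((Fin n → ℝ) × ℝ) :=
  {p | l2dist p.1 X.1 < X.2 - φ X.1 ∧
       φ p.1 + (X.2 - φ X.1) / 2 < p.2 ∧ p.2 < φ p.1 + 3 * (X.2 - φ X.1) / 2}

/-- The (FKP) `φ`-adapted Carleson norm
`‖B‖_{𝒞_φ} = sup_Q ( |Q|⁻¹ ∬_{R_{Q,φ}} ‖B‖²_{L^∞(W_φ(y,s))} dy ds/(s - φ(y)) )^{1/2}`. -/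
noncomputable def carlesonPhi (n : ℕ) (φ : (Fin n → ℝ) → ℝ)
    (B : (Fin n → ℝ) × ℝ → Matrix (Fin (n + 1)) (Fin (n + 1)) ℝ) : ℝ≥0∞ :=
  (⨆ (y₀ : Fin n → ℝ) (r : ℝ) (_ : 0 < r),
      (ENNReal.ofReal ((2 * r) ^ n))⁻¹ *
        ∫⁻ X in RboxPhi n φ y₀ r,
          (essSup (fun Z => ENNReal.ofReal (eopNorm (B Z)))
              (volume.restrict (WphiRegion n φ X))) ^ 2 *
            ENNReal.ofReal ((X.2 - φ X.1)⁻¹)) ^ (1 / 2 : ℝ)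

/-- The localized coefficient matrix `A_{τ,φ}`: equal to `A(0)` when `x ∉ Q_τ`,
to `A(x,t)` in the Carleson box `R_{Q_τ,φ}`, and to `A(x,φ(x))` otherwise. -/
noncomputable def Acut {n : ℕ} (A : (Fin n → ℝ) × ℝ → Matrix (Fin (n + 1)) (Fin (n + 1)) ℝ)
    (φ : (Fin n → ℝ) → ℝ) (τ : ℝ) (X : (Fin n → ℝ) × ℝ) :
    Matrix (Fin (n + 1)) (Fin (n + 1)) ℝ :=
  open Classical in
  if ‖X.1‖ < τ then (if X ∈ RboxPhi n φ 0 τ then A X else A (X.1, φ X.1)) else A (0, 0)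

/-- The `t`-independent part `A₁(x) = A(x,φ(x)) 𝟙_{Q_τ}(x) + A(0)(1 - 𝟙_{Q_τ}(x))`. -/
noncomputable def Aone {n : ℕ} (A : (Fin n → ℝ) × ℝ → Matrix (Fin (n + 1)) (Fin (n + 1)) ℝ)
    (φ : (Fin n → ℝ) → ℝ) (τ : ℝ) (x : Fin n → ℝ) :
    Matrix (Fin (n + 1)) (Fin (n + 1)) ℝ :=
  open Classical in
  if ‖x‖ < τ then A (x, φ x) else A (0, 0)

lemma continuous_l2dist_left {n : ℕ} (y : Fin n → ℝ) :
    Continuous fun x : Fin n → ℝ => l2dist x y := by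
  unfold l2dist
  fun_prop

lemma continuous_of_abs_sub_le_mul_l2dist {n : ℕ} {φ : (Fin n → ℝ) → ℝ} {γ : ℝ}
    (hφ : ∀ x y : Fin n → ℝ, |φ x - φ y| ≤ γ * l2dist x y) : Continuous φ := by
  rw [continuous_iff_continuousAt]
  intro y
  rw [ContinuousAt, tendsto_iff_dist_tendsto_zero]
  have h : Filter.Tendsto (fun x => γ * l2dist x y) (nhds y) (nhds (γ * l2dist y y)) :=
    ((continuous_l2dist_left y).const_mul γ).tendsto y
  have h0 : γ * l2dist y y = 0 := by simp [l2dist]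
  rw [h0] at h
  exact squeeze_zero (fun _ => dist_nonneg) (fun x => by simpa [Real.dist_eq] using hφ x y) h

lemma measurableSet_RboxPhi {n : ℕ} {φ : (Fin n → ℝ) → ℝ} (hφ : Continuous φ)
    (y₀ : Fin n → ℝ) (r : ℝ) : MeasurableSet (RboxPhi n φ y₀ r) := by
  apply IsOpen.measurableSet
  simp only [RboxPhi, Set.ofPred_and]
  refine (isOpen_lt ?_ ?_).inter ((isOpen_lt ?_ ?_).inter (isOpen_lt ?_ ?_)) <;> fun_prop

lemma measurableSet_WphiRegion {n : ℕ} {φ : (Fin n → ℝ) → ℝ} (hφ : Continuous φ)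
    (X : (Fin n → ℝ) × ℝ) : MeasurableSet (WphiRegion n φ X) := by
  apply IsOpen.measurableSet
  have hd := (continuous_l2dist_left X.1).comp (continuous_fst (Y := ℝ))
  simp only [WphiRegion, Set.ofPred_and]
  refine (isOpen_lt hd ?_).inter ((isOpen_lt ?_ ?_).inter (isOpen_lt ?_ ?_)) <;> fun_prop

lemma eopNorm_zero {m : ℕ} : eopNorm (0 : Matrix (Fin m) (Fin m) ℝ) = 0 := by
  simp [eopNorm]

lemma enorm2_graph_le {n : ℕ} (hn : 1 ≤ n) {φ : (Fin n → ℝ) → ℝ} {γ : ℝ} (hφ0 : φ 0 = 0)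
    (hγ : γ ≤ 1) (hφ : ∀ x y : Fin n → ℝ, |φ x - φ y| ≤ γ * l2dist x y)
    {x : Fin n → ℝ} {τ : ℝ} (hx : ‖x‖ < τ) : enorm2 (x, φ x) ≤ 2 * n * τ := by
  have hτ : 0 < τ := (norm_nonneg x).trans_lt hx
  have hn' : (1 : ℝ) ≤ n := by exact_mod_cast hn
  have hS0 : 0 ≤ ∑ i, x i ^ 2 := Finset.sum_nonneg fun i _ => sq_nonneg _
  have hS : ∑ i, x i ^ 2 ≤ n * τ ^ 2 := by
    have : ∑ i, x i ^ 2 ≤ ∑ _i : Fin n, τ ^ 2 := by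
      refine Finset.sum_le_sum fun i _ => ?_
      have h := (norm_le_pi_norm x i).trans hx.le
      rw [Real.norm_eq_abs] at h
      exact sq_le_sq' (abs_le.1 h).1 (abs_le.1 h).2
    simpa using this
  have hl : l2dist x 0 = Real.sqrt (∑ i, x i ^ 2) := by simp [l2dist]
  have hφx : |φ x| ≤ Real.sqrt (∑ i, x i ^ 2) := by
    have h := hφ x 0
    rw [hφ0, sub_zero, hl] at h
    exact h.trans (mul_le_of_le_one_left (Real.sqrt_nonneg _) hγ)
  have hφ2 : φ x ^ 2 ≤ ∑ i, x i ^ 2 := by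
    rw [← sq_abs, ← Real.sq_sqrt hS0]
    gcongr
  apply Real.sqrt_le_iff.2 ⟨by positivity, ?_⟩
  have : (n : ℝ) * τ ^ 2 ≤ n * (n * τ ^ 2) := by
    have : 0 ≤ (n : ℝ) * τ ^ 2 := by positivity
    nlinarith
  simp only
  nlinarith

lemma eopNorm_Acut_sub_Aone_le {n : ℕ} {CA α : ℝ} (hCA : 0 ≤ CA)
    {A : (Fin n → ℝ) × ℝ → Matrix (Fin (n + 1)) (Fin (n + 1)) ℝ} (φ : (Fin n → ℝ) → ℝ)
    (hA : ∀ X Y, eopNorm (A X - A Y) ≤ CA * enorm2 (X - Y) ^ α) (τ : ℝ)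
    {Z : (Fin n → ℝ) × ℝ} (hZ : φ Z.1 < Z.2) :
    eopNorm (Acut A φ τ Z - Aone A φ τ Z.1) ≤ CA * (Z.2 - φ Z.1) ^ α := by
  have hu : 0 < Z.2 - φ Z.1 := sub_pos.2 hZ
  have hnn : 0 ≤ CA * (Z.2 - φ Z.1) ^ α := by positivity
  unfold Acut Aone
  split_ifs with h1 h2
  · have h := hA Z (Z.1, φ Z.1)
    have he : enorm2 (Z - (Z.1, φ Z.1)) = Z.2 - φ Z.1 := by
      simp [enorm2, Real.sqrt_sq hu.le]
    rwa [he] at h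
  · simpa [eopNorm_zero] using hnn
  · simpa [eopNorm_zero] using hnn

lemma Acut_sub_Aone_eq_zero {n : ℕ}
    (A : (Fin n → ℝ) × ℝ → Matrix (Fin (n + 1)) (Fin (n + 1)) ℝ) (φ : (Fin n → ℝ) → ℝ)
    {τ : ℝ} {Z : (Fin n → ℝ) × ℝ} (hZ : φ Z.1 + 2 * τ ≤ Z.2) :
    Acut A φ τ Z - Aone A φ τ Z.1 = 0 := by
  unfold Acut Aone
  split_ifs with h1 h2
  · exact absurd h2.2.2 (not_lt.2 hZ)
  · simp
  · simp

lemma essSup_WphiRegion_le {n : ℕ} {CA α : ℝ} (hCA : 0 ≤ CA) (hα : 0 ≤ α)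
    {A : (Fin n → ℝ) × ℝ → Matrix (Fin (n + 1)) (Fin (n + 1)) ℝ} {φ : (Fin n → ℝ) → ℝ}
    (hφ : Continuous φ)
    (hA : ∀ X Y, eopNorm (A X - A Y) ≤ CA * enorm2 (X - Y) ^ α) (τ : ℝ)
    {X : (Fin n → ℝ) × ℝ} (hX : φ X.1 < X.2) :
    essSup (fun Z => ENNReal.ofReal (eopNorm (Acut A φ τ Z - Aone A φ τ Z.1)))
        (volume.restrict (WphiRegion n φ X)) ≤
      if X.2 - φ X.1 < 4 * τ then
        ENNReal.ofReal (CA * (3 / 2 * (X.2 - φ X.1)) ^ α) else 0 := by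
  have ht : 0 < X.2 - φ X.1 := sub_pos.2 hX
  refine essSup_le_of_ae_le _ ?_
  refine ae_restrict_of_forall_mem (measurableSet_WphiRegion hφ X) fun Z hZ => ?_
  obtain ⟨-, h1, h2⟩ := hZ
  split_ifs with h
  · refine ENNReal.ofReal_le_ofReal
      ((eopNorm_Acut_sub_Aone_le hCA φ hA τ (by linarith)).trans ?_)
    gcongr
    · linarith
    · linarith
  · beta_reduce
    rw [Acut_sub_Aone_eq_zero A φ (by linarith), eopNorm_zero, ENNReal.ofReal_zero]

lemma lintegral_Ioo_rpow {a b : ℝ} (ha : -1 < a) (hb : 0 ≤ b) :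
    ∫⁻ t in Set.Ioo 0 b, ENNReal.ofReal (t ^ a) =
      ENNReal.ofReal (b ^ (a + 1) / (a + 1)) := by
  have hi : IntegrableOn (fun t : ℝ => t ^ a) (Set.Ioo 0 b) :=
    ((intervalIntegrable_iff_integrableOn_Ioc_of_le hb).1
      (intervalIntegral.intervalIntegrable_rpow' ha)).mono_set Set.Ioo_subset_Ioc_self
  rw [← ofReal_integral_eq_lintegral_ofReal hi
    (ae_restrict_of_forall_mem measurableSet_Ioo fun t ht => Real.rpow_nonneg ht.1.le a),
    ← integral_Ioc_eq_integral_Ioo, ← intervalIntegral.integral_of_le hb,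
    integral_rpow (Or.inl ha), Real.zero_rpow (by linarith), sub_zero]

lemma setLIntegral_RboxPhi_le {n : ℕ} {φ : (Fin n → ℝ) → ℝ} (hφ : Continuous φ)
    (y₀ : Fin n → ℝ) {r : ℝ} (hr : 0 < r) (F : (Fin n → ℝ) × ℝ → ℝ≥0∞) (G : ℝ → ℝ≥0∞)
    (hFG : ∀ X ∈ RboxPhi n φ y₀ r, F X ≤ G (X.2 - φ X.1)) :
    ∫⁻ X in RboxPhi n φ y₀ r, F X ≤ ENNReal.ofReal ((2 * r) ^ n) * ∫⁻ t, G t := by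
  rw [← lintegral_indicator (measurableSet_RboxPhi hφ y₀ r)]
  calc ∫⁻ X, (RboxPhi n φ y₀ r).indicator F X
      ≤ ∫⁻ X : (Fin n → ℝ) × ℝ, (Metric.ball y₀ r).indicator 1 X.1 * G (X.2 - φ X.1) := by
        refine lintegral_mono fun X => ?_
        by_cases hX : X ∈ RboxPhi n φ y₀ r
        · have : X.1 ∈ Metric.ball y₀ r := by simpa [dist_eq_norm] using hX.1
          simpa [hX, this] using hFG X hX
        · simp [hX]
    _ ≤ ∫⁻ x : Fin n → ℝ, ∫⁻ s : ℝ, (Metric.ball y₀ r).indicator 1 x * G (s - φ x) :=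
        lintegral_prod_le _
    _ = ∫⁻ x : Fin n → ℝ, (Metric.ball y₀ r).indicator (fun _ => ∫⁻ t, G t) x := by
        refine lintegral_congr fun x => ?_
        by_cases hx : x ∈ Metric.ball y₀ r
        · simpa only [Set.indicator_of_mem hx, Pi.one_apply, one_mul] using
            lintegral_sub_right_eq_self G (φ x)
        · simp [hx]
    _ = ENNReal.ofReal ((2 * r) ^ n) * ∫⁻ t, G t := by
        rw [lintegral_indicator Metric.isOpen_ball.measurableSet, setLIntegral_const,
          Real.volume_pi_ball y₀ hr, Fintype.card_fin, mul_comm]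

lemma carlesonPhi_Acut_sub_Aone_le {n : ℕ} {CA α : ℝ} (hCA : 0 ≤ CA) (hα : 0 < α)
    {A : (Fin n → ℝ) × ℝ → Matrix (Fin (n + 1)) (Fin (n + 1)) ℝ} {φ : (Fin n → ℝ) → ℝ}
    (hφ : Continuous φ)
    (hA : ∀ X Y, eopNorm (A X - A Y) ≤ CA * enorm2 (X - Y) ^ α) {τ : ℝ} (hτ : 0 < τ) :
    carlesonPhi n φ (fun X => Acut A φ τ X - Aone A φ τ X.1) ≤
      ENNReal.ofReal (CA * 6 ^ α / Real.sqrt (2 * α) * τ ^ α) := by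
  set K : ℝ := (CA * (3 / 2) ^ α) ^ 2 with hK
  set D : ℝ := CA * 6 ^ α / Real.sqrt (2 * α) * τ ^ α with hD
  have hK0 : 0 ≤ K := by positivity
  have hD0 : 0 ≤ D := by positivity
  have hKD : K * ((4 * τ) ^ (2 * α) / (2 * α)) = D ^ 2 := by
    rw [hK, hD, mul_pow _ (τ ^ α), div_pow _ (Real.sqrt _), Real.sq_sqrt (by positivity),
      mul_comm 2 α, Real.rpow_mul (by positivity), Real.mul_rpow (by norm_num) hτ.le,
      Real.rpow_two, show (6 : ℝ) = 3 / 2 * 4 by norm_num,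
      Real.mul_rpow (x := 3 / 2) (by norm_num) (by norm_num)]
    ring
  let G : ℝ → ℝ≥0∞ := (Set.Ioo 0 (4 * τ)).indicator
    fun t => ENNReal.ofReal K * ENNReal.ofReal (t ^ (2 * α - 1))
  have hG : ∫⁻ t, G t = ENNReal.ofReal (D ^ 2) := by
    rw [lintegral_indicator measurableSet_Ioo, lintegral_const_mul' _ _ ENNReal.ofReal_ne_top,
      lintegral_Ioo_rpow (by linarith) (by positivity), ← ENNReal.ofReal_mul hK0,
      sub_add_cancel, hKD]
  have key : ∀ (y₀ : Fin n → ℝ) (r : ℝ), ∀ X ∈ RboxPhi n φ y₀ r,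
      (essSup (fun Z => ENNReal.ofReal (eopNorm (Acut A φ τ Z - Aone A φ τ Z.1)))
          (volume.restrict (WphiRegion n φ X))) ^ 2 * ENNReal.ofReal ((X.2 - φ X.1)⁻¹) ≤
        G (X.2 - φ X.1) := by
    intro y₀ r X hX
    have ht : 0 < X.2 - φ X.1 := sub_pos.2 hX.2.1
    have h := essSup_WphiRegion_le hCA hα.le hφ hA τ hX.2.1
    refine (mul_le_mul_left (pow_le_pow_left' h 2) _).trans ?_
    split_ifs with hlt
    · have hmem : X.2 - φ X.1 ∈ Set.Ioo 0 (4 * τ) := ⟨ht, hlt⟩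
      simp only [G, Set.indicator_of_mem hmem]
      rw [← ENNReal.ofReal_pow (by positivity), ← ENNReal.ofReal_mul (by positivity),
        ← ENNReal.ofReal_mul hK0]
      apply le_of_eq
      congr 1
      rw [hK, Real.mul_rpow (by norm_num) ht.le, Real.rpow_sub ht, Real.rpow_one,
        mul_comm 2 α, Real.rpow_mul ht.le, Real.rpow_two]
      ring
    · simp
  calc carlesonPhi n φ (fun X => Acut A φ τ X - Aone A φ τ X.1)
      ≤ ENNReal.ofReal (D ^ 2) ^ (1 / 2 : ℝ) := by
        refine ENNReal.rpow_le_rpow (iSup_le fun y₀ => iSup_le fun r => iSup_le fun hr => ?_)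
          (by norm_num)
        have hv : 0 < (2 * r) ^ n := by positivity
        refine (mul_le_mul_right (setLIntegral_RboxPhi_le hφ y₀ hr _ G (key y₀ r)) _).trans ?_
        rw [hG, ← mul_assoc, ENNReal.inv_mul_cancel (ENNReal.ofReal_pos.2 hv).ne'
          ENNReal.ofReal_ne_top, one_mul]
    _ = ENNReal.ofReal D := by
        rw [ENNReal.ofReal_rpow_of_nonneg (by positivity) (by norm_num), ← Real.sqrt_eq_rpow,
          Real.sqrt_sq hD0]

/-- Lemma 4.1: for a Lipschitz `φ` with constant `γ ≤ 1/(50n)`, `φ(0) = 0`,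
and a `Λ`-elliptic, `C_A`-Hölder continuous matrix `A`, the decomposition
`A_{τ,φ} = A₁ + B` satisfies `‖A₁ - A(0)‖_{L^∞(ℝⁿ)} + ‖B‖_{𝒞_φ} ≤ C₁ τ^α`
with `C₁` depending only on `C_A`, `n` and `α`. -/
theorem holder_localization_carleson (n : ℕ) (hn : 2 ≤ n) (CA α : ℝ)
    (hCA : 0 < CA) (hα0 : 0 < α) (hα1 : α ≤ 1) :
    ∃ C₁ : ℝ, 0 < C₁ ∧
      ∀ (Λ : ℝ), 1 ≤ Λ →
      ∀ (φ : (Fin n → ℝ) → ℝ) (γ : ℝ), φ 0 = 0 → γ ≤ 1 / (50 * n) →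
        (∀ x y : Fin n → ℝ, |φ x - φ y| ≤ γ * l2dist x y) →
      ∀ A : (Fin n → ℝ) × ℝ → Matrix (Fin (n + 1)) (Fin (n + 1)) ℝ,
        (∀ X, eopNorm (A X) ≤ Λ) →
        (∀ X (ξ : Fin (n + 1) → ℝ),
          Λ⁻¹ * ∑ i, ξ i ^ 2 ≤ dotProduct ((A X).mulVec ξ) ξ) →
        (∀ X Y, eopNorm (A X - A Y) ≤ CA * enorm2 (X - Y) ^ α) →
      ∀ τ : ℝ, 0 < τ →
        essSup (fun x => ENNReal.ofReal (eopNorm (Aone A φ τ x - A (0, 0)))) volume +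
            carlesonPhi n φ (fun X => Acut A φ τ X - Aone A φ τ X.1) ≤
          ENNReal.ofReal (C₁ * τ ^ α) := by
  have hn0 : (0 : ℝ) < n := by exact_mod_cast (by omega : 0 < n)
  refine ⟨CA * (2 * n) ^ α + CA * 6 ^ α / Real.sqrt (2 * α), by positivity, ?_⟩
  intro Λ _ φ γ hφ0 hγ hφ A _ _ hA τ hτ
  have hγ1 : γ ≤ 1 := by
    refine hγ.trans ((div_le_one (by positivity)).2 ?_)
    have : (2 : ℝ) ≤ n := by exact_mod_cast hn
    linarith
  have hAone : essSup (fun x => ENNReal.ofReal (eopNorm (Aone A φ τ x - A (0, 0)))) volume ≤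
      ENNReal.ofReal (CA * (2 * n) ^ α * τ ^ α) := by
    refine essSup_le_of_ae_le _ (Filter.Eventually.of_forall fun x => ?_)
    refine ENNReal.ofReal_le_ofReal ?_
    unfold Aone
    split_ifs with hx
    · have h := hA (x, φ x) (0, 0)
      rw [show ((x, φ x) - (0, 0) : (Fin n → ℝ) × ℝ) = (x, φ x) by simp] at h
      rw [mul_assoc, ← Real.mul_rpow (by positivity) hτ.le]
      refine h.trans (mul_le_mul_of_nonneg_left ?_ hCA.le)
      exact Real.rpow_le_rpow (Real.sqrt_nonneg _)
        (enorm2_graph_le (by omega) hφ0 hγ1 hφ hx) hα0.le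
    · rw [sub_self, eopNorm_zero]
      positivity
  rw [add_mul, ENNReal.ofReal_add (by positivity) (by positivity)]
  exact add_le_add hAone (carlesonPhi_Acut_sub_Aone_le hCA.le hα0
    (continuous_of_abs_sub_le_mul_l2dist hφ) hA hτ)
end

section
/- Let n ≥ 2 and let φ: ℝⁿ → ℝ be a Lipschitz function with φ(0) = 0 which is differentiable almost everywhere with |∇φ(x)| ≤ γ (Euclidean norm) for a.e. x. Let Φ(x,t) = (x, t − φ(x)) be the flattening map, and let J_Φ(x) be the (n+1)×(n+1) matrix with block form [[Iₙ, −∇φ(x)],[0,1]]. Then for every measurable (n+1)×(n+1) matrix-valued function B on Ω_φ = {(x,t) : t > φ(x)}, the matrix-valued function B̃ := J_Φᵀ (B ∘ Φ^{−1}) J_Φ on ℝ^{n+1}_+ satisfies ‖B̃‖_𝒞 ≤ (1 + γ)² ‖B‖_{𝒞_φ}. -/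
open scoped BigOperators ENNReal
open Matrix MeasureTheory

/-- The Jacobian matrix `J(v)` of the flattening map, in block form `[[Iₙ, -v],[0,1]]`. -/
noncomputable def Jmat (n : ℕ) (v : Fin n → ℝ) : Matrix (Fin (n + 1)) (Fin (n + 1)) ℝ :=
  Matrix.of fun i j =>
    (if i = j then (1 : ℝ) else 0) +
      (if j = Fin.last n then -((Fin.snoc v (0 : ℝ) : Fin (n + 1) → ℝ) i) else 0)

/-- The gradient `∇φ(x)` of `φ : ℝⁿ → ℝ`, as the vector of partial derivatives. -/
noncomputable def gradPhi {n : ℕ} (φ : (Fin n → ℝ) → ℝ) (x : Fin n → ℝ) : Fin n → ℝ :=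
  fun i => fderiv ℝ φ x (Pi.single i 1)

/-- The Whitney region `W(y,s) = Δ(y, s/2) × (s/2, 3s/2)` in the upper half space. -/
noncomputable def WupRegion (n : ℕ) (y : Fin n → ℝ) (s : ℝ) : Set ((Fin n → ℝ) × ℝ) :=
  {p | l2dist p.1 y < s / 2 ∧ s / 2 < p.2 ∧ p.2 < 3 * s / 2}

/-- The Carleson box `R_Q = Q × (0, ℓ(Q))` with `Q` the cube of center `y₀`, half side `r`. -/
def RboxUp (n : ℕ) (y₀ : Fin n → ℝ) (r : ℝ) : Set ((Fin n → ℝ) × ℝ) :=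
  {p | ‖p.1 - y₀‖ < r ∧ 0 < p.2 ∧ p.2 < 2 * r}

/-- The FKP-Carleson norm `‖B‖_𝒞` on the upper half space. -/
noncomputable def carlesonUp (n : ℕ)
    (B : (Fin n → ℝ) × ℝ → Matrix (Fin (n + 1)) (Fin (n + 1)) ℝ) : ℝ≥0∞ :=
  (⨆ (y₀ : Fin n → ℝ) (r : ℝ) (_ : 0 < r),
      (ENNReal.ofReal ((2 * r) ^ n))⁻¹ *
        ∫⁻ X in RboxUp n y₀ r,
          (essSup (fun Z => ENNReal.ofReal (eopNorm (B Z)))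
              (volume.restrict (WupRegion n X.1 X.2))) ^ 2 *
            ENNReal.ofReal (X.2⁻¹)) ^ (1 / 2 : ℝ)

/-- The shear `(x, t) ↦ (x, t + φ x)`, inverse of the flattening map of the graph of `φ`. -/
def graphShear {n : ℕ} (φ : (Fin n → ℝ) → ℝ) (X : (Fin n → ℝ) × ℝ) : (Fin n → ℝ) × ℝ :=
  (X.1, X.2 + φ X.1)

lemma measurableEmbedding_graphShear {n : ℕ} {φ : (Fin n → ℝ) → ℝ} (hφ : Continuous φ) :
    MeasurableEmbedding (graphShear φ) := by
  let e : (Fin n → ℝ) × ℝ ≃ₜ (Fin n → ℝ) × ℝ :=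
    { toFun := graphShear φ
      invFun := fun X => (X.1, X.2 - φ X.1)
      left_inv := fun X => by simp [graphShear]
      right_inv := fun X => by simp [graphShear]
      continuous_toFun := by unfold graphShear; fun_prop
      continuous_invFun := by fun_prop }
  exact e.measurableEmbedding

lemma measurePreserving_graphShear {n : ℕ} {φ : (Fin n → ℝ) → ℝ} (hφ : Continuous φ) :
    MeasurePreserving (graphShear φ) volume volume :=
  (MeasurePreserving.id volume).skew_product (g := fun x t => t + φ x)
    (by
      have : Continuous (Function.uncurry fun (x : Fin n → ℝ) (t : ℝ) => t + φ x) := by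
        unfold Function.uncurry; fun_prop
      exact this.measurable)
    (Filter.Eventually.of_forall fun x => map_add_right_eq_self volume (φ x))

lemma graphShear_preimage_RboxPhi {n : ℕ} (φ : (Fin n → ℝ) → ℝ) (y₀ : Fin n → ℝ) (r : ℝ) :
    graphShear φ ⁻¹' RboxPhi n φ y₀ r = RboxUp n y₀ r := by
  ext X
  simp only [graphShear, RboxPhi, RboxUp, Set.mem_preimage, Set.mem_ofPred_eq,
    add_comm X.2, add_lt_add_iff_left, lt_add_iff_pos_right]

lemma WupRegion_subset_graphShear_preimage {n : ℕ} (φ : (Fin n → ℝ) → ℝ)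
    (X : (Fin n → ℝ) × ℝ) :
    WupRegion n X.1 X.2 ⊆ graphShear φ ⁻¹' WphiRegion n φ (graphShear φ X) := by
  rintro Z ⟨h₁, h₂, h₃⟩
  simp only [graphShear, WphiRegion, Set.mem_preimage, Set.mem_ofPred_eq, add_sub_cancel_right]
  exact ⟨by linarith, by linarith, by linarith⟩

lemma measurableSet_WupRegion (n : ℕ) (y : Fin n → ℝ) (s : ℝ) :
    MeasurableSet (WupRegion n y s) := by
  have h : Continuous fun p : (Fin n → ℝ) × ℝ => l2dist p.1 y := by
    unfold l2dist; fun_prop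
  exact ((isOpen_lt h continuous_const).inter ((isOpen_lt continuous_const continuous_snd).inter
    (isOpen_lt continuous_snd continuous_const))).measurableSet

lemma essSup_comp_graphShear_le {n : ℕ} {φ : (Fin n → ℝ) → ℝ} (hφ : Continuous φ)
    (f : (Fin n → ℝ) × ℝ → ℝ≥0∞) (X : (Fin n → ℝ) × ℝ) :
    essSup (fun Z => f (graphShear φ Z)) (volume.restrict (WupRegion n X.1 X.2)) ≤
      essSup f (volume.restrict (WphiRegion n φ (graphShear φ X))) := by
  refine essSup_le_of_ae_le _ ?_
  have h := (measurePreserving_graphShear hφ).quasiMeasurePreserving.ae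
    (ae_imp_of_ae_restrict (ENNReal.ae_le_essSup (μ := volume.restrict
      (WphiRegion n φ (graphShear φ X))) f))
  refine (ae_restrict_iff' (measurableSet_WupRegion n X.1 X.2)).2 ?_
  filter_upwards [h] with Z hZ hmem
  exact hZ (WupRegion_subset_graphShear_preimage φ X hmem)

section OperatorNorm

open scoped Matrix.Norms.L2Operator

lemma eopNorm_eq_l2_opNorm {m : ℕ} (M : Matrix (Fin m) (Fin m) ℝ) : eopNorm M = ‖M‖ := rfl

lemma eopNorm_transpose_mul_mul_le {m : ℕ} (J M : Matrix (Fin m) (Fin m) ℝ) :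
    eopNorm (Jᵀ * M * J) ≤ eopNorm J ^ 2 * eopNorm M := by
  simp only [eopNorm_eq_l2_opNorm]
  have hJ : ‖Jᵀ‖ = ‖J‖ := by
    rw [← Matrix.conjTranspose_eq_transpose_of_trivial, Matrix.l2_opNorm_conjTranspose]
  calc ‖Jᵀ * M * J‖ ≤ ‖Jᵀ * M‖ * ‖J‖ := Matrix.l2_opNorm_mul _ _
    _ ≤ ‖Jᵀ‖ * ‖M‖ * ‖J‖ := by gcongr; exact Matrix.l2_opNorm_mul _ _
    _ = ‖J‖ ^ 2 * ‖M‖ := by rw [hJ]; ring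

lemma l2_opNorm_vecMulVec_le {m : ℕ} (u v : Fin m → ℝ) :
    ‖Matrix.vecMulVec u v‖ ≤ ‖WithLp.toLp 2 u‖ * ‖WithLp.toLp 2 v‖ := by
  refine ContinuousLinearMap.opNorm_le_bound _ (by positivity) fun x => ?_
  have h : (LinearMap.toContinuousLinearMap (Matrix.toEuclideanLin (Matrix.vecMulVec u v))) x
      = inner ℝ (WithLp.toLp 2 v) x • WithLp.toLp 2 u := by
    ext i
    simp [Matrix.mulVec, dotProduct, Matrix.vecMulVec_apply, PiLp.inner_apply,
      Finset.sum_mul]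
    exact Finset.sum_congr rfl fun j _ => by ring
  change ‖(LinearMap.toContinuousLinearMap (Matrix.toEuclideanLin (Matrix.vecMulVec u v))) x‖ ≤ _
  rw [h, norm_smul, mul_comm, mul_assoc]
  gcongr
  exact norm_inner_le_norm _ _

lemma Jmat_eq_one_add_vecMulVec (n : ℕ) (v : Fin n → ℝ) :
    Jmat n v = 1 + Matrix.vecMulVec (-(Fin.snoc v (0 : ℝ) : Fin (n + 1) → ℝ))
      (Pi.single (Fin.last n) 1) := by
  ext i j
  by_cases hj : j = Fin.last n <;>
    simp [Jmat, Matrix.one_apply, Matrix.vecMulVec_apply, hj]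

lemma eopNorm_Jmat_le (n : ℕ) (v : Fin n → ℝ) :
    eopNorm (Jmat n v) ≤ 1 + Real.sqrt (∑ i, v i ^ 2) := by
  rw [eopNorm_eq_l2_opNorm, Jmat_eq_one_add_vecMulVec]
  refine (norm_add_le _ _).trans (add_le_add ?_ ((l2_opNorm_vecMulVec_le _ _).trans_eq ?_))
  · exact (CStarRing.norm_one (E := Matrix (Fin (n + 1)) (Fin (n + 1)) ℝ)).le
  · simp [EuclideanSpace.norm_eq, Fin.sum_univ_castSucc]

end OperatorNorm

/-- for a Lipschitz `φ` with `φ(0) = 0`, differentiable a.e. with `|∇φ| ≤ γ`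
a.e., the pullback `B̃ = J_Φᵀ (B ∘ Φ⁻¹) J_Φ` under the flattening map `Φ(x,t) = (x, t - φ(x))`
satisfies `‖B̃‖_𝒞 ≤ (1+γ)² ‖B‖_{𝒞_φ}`. -/
theorem carleson_norm_pullback (n : ℕ) (hn : 2 ≤ n)
    (φ : (Fin n → ℝ) → ℝ) (hφ0 : φ 0 = 0)
    (K : NNReal) (hLip : LipschitzWith K φ)
    (γ : ℝ)
    (hgrad : ∀ᵐ x : Fin n → ℝ ∂volume,
      DifferentiableAt ℝ φ x ∧ Real.sqrt (∑ i, gradPhi φ x i ^ 2) ≤ γ)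
    (B : (Fin n → ℝ) × ℝ → Matrix (Fin (n + 1)) (Fin (n + 1)) ℝ)
    (hBmeas : ∀ i j, Measurable fun X => B X i j) :
    carlesonUp n
        (fun X => (Jmat n (gradPhi φ X.1))ᵀ * B (X.1, X.2 + φ X.1) * Jmat n (gradPhi φ X.1)) ≤
      ENNReal.ofReal ((1 + γ) ^ 2) * carlesonPhi n φ B := by
  have hφ := hLip.continuous
  have hγ : 0 ≤ γ := by
    obtain ⟨x, -, hx⟩ := hgrad.exists
    exact (Real.sqrt_nonneg _).trans hx
  set c : ℝ≥0∞ := ENNReal.ofReal ((1 + γ) ^ 2) with hc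
  set B' : (Fin n → ℝ) × ℝ → Matrix (Fin (n + 1)) (Fin (n + 1)) ℝ := fun X =>
    (Jmat n (gradPhi φ X.1))ᵀ * B (X.1, X.2 + φ X.1) * Jmat n (gradPhi φ X.1) with hB'
  have hB'_le : ∀ᵐ Z : (Fin n → ℝ) × ℝ, ENNReal.ofReal (eopNorm (B' Z)) ≤
      c * ENNReal.ofReal (eopNorm (B (graphShear φ Z))) := by
    have h := (Measure.quasiMeasurePreserving_fst (μ := (volume : Measure (Fin n → ℝ)))
      (ν := (volume : Measure ℝ))).ae hgrad
    filter_upwards [h] with Z hZ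
    rw [hc, ← ENNReal.ofReal_mul (by positivity)]
    refine ENNReal.ofReal_le_ofReal ((eopNorm_transpose_mul_mul_le _ _).trans ?_)
    refine mul_le_mul_of_nonneg_right ?_ (norm_nonneg _)
    exact pow_le_pow_left₀ (norm_nonneg _)
      ((eopNorm_Jmat_le n _).trans (by linarith [hZ.2])) 2
  have hsup : ∀ X : (Fin n → ℝ) × ℝ,
      essSup (fun Z => ENNReal.ofReal (eopNorm (B' Z)))
        (volume.restrict (WupRegion n X.1 X.2)) ≤
      c * essSup (fun Z => ENNReal.ofReal (eopNorm (B Z)))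
        (volume.restrict (WphiRegion n φ (graphShear φ X))) := fun X => by
    refine (essSup_mono_ae (ae_restrict_of_ae hB'_le)).trans ?_
    rw [ENNReal.essSup_const_mul]
    gcongr
    exact essSup_comp_graphShear_le hφ (fun Z => ENNReal.ofReal (eopNorm (B Z))) X
  have hroot : c = (c ^ 2) ^ (1 / 2 : ℝ) := by
    rw [← ENNReal.rpow_natCast, ← ENNReal.rpow_mul]; norm_num
  unfold carlesonUp carlesonPhi
  conv_rhs => rw [hroot]
  rw [← ENNReal.mul_rpow_of_nonneg _ _ (by norm_num)]
  refine ENNReal.rpow_le_rpow (iSup_le fun y₀ => iSup_le fun r => iSup_le fun hr => ?_)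
    (by norm_num)
  simp only [ENNReal.mul_iSup]
  refine le_iSup_of_le y₀ (le_iSup_of_le r (le_iSup_of_le hr ?_))
  rw [← (measurePreserving_graphShear hφ).setLIntegral_comp_preimage_emb
    (measurableEmbedding_graphShear hφ) _ (RboxPhi n φ y₀ r),
    graphShear_preimage_RboxPhi, mul_left_comm,
    ← lintegral_const_mul' (c ^ 2) _ (by finiteness)]
  refine mul_le_mul' le_rfl (lintegral_mono fun X => ?_)
  simp only [← mul_assoc, ← mul_pow]
  refine mul_le_mul' (pow_le_pow_left₀ zero_le (hsup X) 2) ?_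
  simp [graphShear]
end

section
/- Let n ≥ 1, y ∈ ℝⁿ and s > 0. Let f ≥ 0 be a Lebesgue-integrable function on the ball B(y, s) satisfying the reverse Hölder inequality ( ⨍_{B(y,s)} f² dx )^{1/2} ≤ 2 ⨍_{B(y,s)} f dx. Then for every s′ with (3/4)^{1/n} s < s′ < s one has ∫_{B(y,s)} f dx ≤ (1 − 2((sⁿ − (s′)ⁿ)/sⁿ)^{1/2})^{−1} ∫_{B(y,s′)} f dx. -/
open MeasureTheory Metric
open scoped BigOperators

/-- Cauchy–Schwarz against the constant function `1` on a finite measure space. -/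
theorem sq_integral_le_measureReal_univ_mul_integral_sq {α : Type*} [MeasurableSpace α]
    {μ : Measure α} [IsFiniteMeasure μ] {f : α → ℝ} (hf : Integrable f μ)
    (hf2 : Integrable (fun x => f x ^ 2) μ) :
    (∫ x, f x ∂μ) ^ 2 ≤ μ.real Set.univ * ∫ x, f x ^ 2 ∂μ := by
  have key : ∀ c : ℝ, 0 ≤ μ.real Set.univ * (c * c) + (-2 * ∫ x, f x ∂μ) * c
      + ∫ x, f x ^ 2 ∂μ := fun c => by
    have h : ∫ x, (f x - c) ^ 2 ∂μ = μ.real Set.univ * (c * c) + (-2 * ∫ x, f x ∂μ) * c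
        + ∫ x, f x ^ 2 ∂μ := by
      have e : ∀ x, (f x - c) ^ 2 = f x ^ 2 - 2 * c * f x + c * c := fun x => by ring
      simp_rw [e]
      have hsub : Integrable (fun x => f x ^ 2 - 2 * c * f x) μ := hf2.sub (hf.const_mul _)
      rw [integral_add hsub (integrable_const _),
        integral_sub hf2 (hf.const_mul _), integral_const_mul, integral_const, smul_eq_mul]
      ring
    exact h ▸ integral_nonneg fun x => sq_nonneg _
  have := discrim_le_zero key
  unfold discrim at this
  linarith

/-- Volume of a Euclidean ball as a multiple of the volume of the unit ball. -/
theorem volume_real_ball_eq_pow_mul {n : ℕ} (y : EuclideanSpace ℝ (Fin n)) {r : ℝ} (hr : 0 < r) :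
    volume.real (ball y r) = r ^ n * volume.real (ball (0 : EuclideanSpace ℝ (Fin n)) 1) := by
  rw [Measure.real, Measure.addHaar_ball_of_pos volume y hr, ENNReal.toReal_mul,
    ENNReal.toReal_ofReal (by positivity), finrank_euclideanSpace_fin, Measure.real]

/-- Claim 4.4: if `f ≥ 0` on `B(y,s)` satisfies the reverse Hölder inequality
`(⨍_{B(y,s)} f²)^{1/2} ≤ 2 ⨍_{B(y,s)} f`, then for `(3/4)^{1/n} s < s' < s` one has
`∫_{B(y,s)} f ≤ (1 - 2((sⁿ - s'ⁿ)/sⁿ)^{1/2})⁻¹ ∫_{B(y,s')} f`. -/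
theorem reverse_holder_annulus_absorption (n : ℕ) (hn : 1 ≤ n)
    (y : EuclideanSpace ℝ (Fin n)) (s s' : ℝ) (hs : 0 < s)
    (f : EuclideanSpace ℝ (Fin n) → ℝ)
    (hf0 : ∀ x ∈ ball y s, 0 ≤ f x)
    (hf1 : IntegrableOn f (ball y s))
    (hf2 : IntegrableOn (fun x => f x ^ 2) (ball y s))
    (hRH : Real.sqrt (⨍ x in ball y s, f x ^ 2) ≤ 2 * ⨍ x in ball y s, f x)
    (hs'1 : (3 / 4 : ℝ) ^ ((1 : ℝ) / n) * s < s') (hs'2 : s' < s) :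
    ∫ x in ball y s, f x ≤
      (1 - 2 * Real.sqrt ((s ^ n - s' ^ n) / s ^ n))⁻¹ * ∫ x in ball y s', f x := by
  have hs' : 0 < s' := lt_trans (by positivity) hs'1
  have hpow : 3 / 4 * s ^ n < s' ^ n := by
    have h := pow_lt_pow_left₀ hs'1 (by positivity) (n := n) (by omega)
    rwa [mul_pow, one_div, Real.rpow_inv_natCast_pow (by norm_num) (by omega)] at h
  have hsn : 0 < s ^ n := by positivity
  have hsqrt : Real.sqrt ((s ^ n - s' ^ n) / s ^ n) < 1 / 2 := by
    rw [Real.sqrt_lt' (by norm_num), div_lt_iff₀ hsn]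
    linarith
  have hsub : ball y s' ⊆ ball y s := ball_subset_ball hs'2.le
  have hAsub : ball y s \ ball y s' ⊆ ball y s := Set.sdiff_subset
  have hV : 0 < volume.real (ball (0 : EuclideanSpace ℝ (Fin n)) 1) :=
    ENNReal.toReal_pos (measure_ball_pos volume _ one_pos).ne' measure_ball_lt_top.ne
  have hA : volume.real (ball y s \ ball y s')
      = (s ^ n - s' ^ n) * volume.real (ball (0 : EuclideanSpace ℝ (Fin n)) 1) := by
    rw [measureReal_sdiff hsub measurableSet_ball, volume_real_ball_eq_pow_mul y hs,
      volume_real_ball_eq_pow_mul y hs', sub_mul]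
  have : IsFiniteMeasure (volume.restrict (ball y s \ ball y s')) :=
    ⟨by simpa using (measure_mono hAsub).trans_lt measure_ball_lt_top⟩
  have hCS := sq_integral_le_measureReal_univ_mul_integral_sq
    (hf1.mono_set hAsub) (hf2.mono_set hAsub)
  rw [measureReal_restrict_apply_univ, hA,
    setIntegral_sdiff measurableSet_ball hf1 hsub] at hCS
  have hmono : ∫ x in ball y s \ ball y s', f x ^ 2 ≤ ∫ x in ball y s, f x ^ 2 :=
    setIntegral_mono_set hf2 (.of_forall fun x => sq_nonneg _) hAsub.eventuallyLE
  have hI : 0 ≤ ∫ x in ball y s, f x := setIntegral_nonneg measurableSet_ball hf0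
  rw [setAverage_eq, setAverage_eq, volume_real_ball_eq_pow_mul y hs, smul_eq_mul, smul_eq_mul,
    Real.sqrt_le_left (by positivity)] at hRH
  set V := volume.real (ball (0 : EuclideanSpace ℝ (Fin n)) 1)
  set I := ∫ x in ball y s, f x
  set J := ∫ x in ball y s', f x
  set Q := ∫ x in ball y s, f x ^ 2
  have hQ : Q ≤ 4 * I ^ 2 / (s ^ n * V) := by
    rw [inv_mul_le_iff₀ (by positivity)] at hRH
    refine hRH.trans_eq ?_
    field_simp
    ring
  have ht : 0 ≤ s ^ n - s' ^ n := sub_nonneg.2 (pow_le_pow_left₀ hs'.le hs'2.le n)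
  have hsq : (I - J) ^ 2 ≤ (2 * Real.sqrt ((s ^ n - s' ^ n) / s ^ n) * I) ^ 2 := by
    rw [mul_pow, mul_pow, Real.sq_sqrt (by positivity)]
    calc (I - J) ^ 2 ≤ (s ^ n - s' ^ n) * V * (4 * I ^ 2 / (s ^ n * V)) :=
          hCS.trans (mul_le_mul_of_nonneg_left (hmono.trans hQ) (by positivity))
      _ = _ := by field_simp; ring
  have hle := abs_le_of_sq_le_sq' hsq (by positivity)
  rw [le_inv_mul_iff₀ (by linarith)]
  linarith [hle.2]
end

section
/- Let n ≥ 2 and Λ ≥ 1. For every β ∈ (0,1) there exists δ₁ = δ₁(β, n, Λ) > 0 such that for every real symmetric (n+1)×(n+1) matrix A₀ with Λ^{−1}|ξ|² ≤ ⟨A₀ξ, ξ⟩ ≤ Λ|ξ|² for all ξ ∈ ℝ^{n+1}, the function K_{A₀}(z) := c_n det(A₀)^{−1/2} ⟨A₀^{−1}e_{n+1}, e_{n+1}⟩^{1/2} ⟨A₀^{−1}(−z,1), (−z,1)⟩^{−(n+1)/2} satisfies ( ⨍_{B(0,δ)} K_{A₀}(z)² dz )^{1/2} ≤ (1 + β)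 ⨍_{B(0,δ)} K_{A₀}(z) dz for all δ ∈ (0, δ₁). -/
open MeasureTheory Matrix
open scoped BigOperators

/-- `c_n = Γ((n+1)/2)/π^{(n+1)/2}`, the normalizing constant of the Poisson kernel for the
Laplacian on the upper half space. -/
noncomputable def poissonConst (n : ℕ) : ℝ :=
  Real.Gamma (((n : ℝ) + 1) / 2) / Real.pi ^ (((n : ℝ) + 1) / 2)

/-- The explicit Poisson kernel with pole `(0,1)` of the constant-coefficient operator
`L₀ = -div(A₀∇)` on the upper half space. -/
noncomputable def poissonKernelConst (n : ℕ) (A₀ : Matrix (Fin (n + 1)) (Fin (n + 1)) ℝ)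
    (z : Fin n → ℝ) : ℝ :=
  poissonConst n * A₀.det ^ (-(1 : ℝ) / 2) *
    Real.sqrt (dotProduct (A₀⁻¹.mulVec (Pi.single (Fin.last n) 1))
      (Pi.single (Fin.last n) 1)) *
    (dotProduct (A₀⁻¹.mulVec (Fin.snoc (fun i => -z i) (1 : ℝ)))
      (Fin.snoc (fun i => -z i) (1 : ℝ))) ^ (-((n : ℝ) + 1) / 2)

section QuadraticForm

variable {ι : Type*} [Fintype ι] {A : Matrix ι ι ℝ}

theorem Matrix.dotProduct_self_eq_sum_sq (x : ι → ℝ) : x ⬝ᵥ x = ∑ i, x i ^ 2 := by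
  simp [dotProduct, sq]

theorem Matrix.IsSymm.mulVec_dotProduct_comm (hA : A.IsSymm) (x y : ι → ℝ) :
    A *ᵥ x ⬝ᵥ y = A *ᵥ y ⬝ᵥ x := by
  rw [dotProduct_comm, dotProduct_mulVec, ← mulVec_transpose, hA.eq]

/-- The quadratic form of a symmetric matrix expanded on a linear combination. -/
theorem Matrix.IsSymm.mulVec_add_smul_dotProduct (hA : A.IsSymm) (x y : ι → ℝ) (t : ℝ) :
    A *ᵥ (x + t • y) ⬝ᵥ (x + t • y) =
      A *ᵥ x ⬝ᵥ x + 2 * t * (A *ᵥ x ⬝ᵥ y) + t ^ 2 * (A *ᵥ y ⬝ᵥ y) := by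
  simp only [mulVec_add, mulVec_smul, add_dotProduct, dotProduct_add, smul_dotProduct,
    dotProduct_smul, smul_eq_mul, hA.mulVec_dotProduct_comm y x]
  ring

theorem Matrix.posDef_of_coercive {c : ℝ} (hc : 0 < c) (hA : A.IsSymm)
    (hlow : ∀ ξ : ι → ℝ, c * ∑ i, ξ i ^ 2 ≤ A *ᵥ ξ ⬝ᵥ ξ) : A.PosDef := by
  refine .of_dotProduct_mulVec_pos (by simpa [IsHermitian, IsSymm] using hA) fun x hx => ?_
  have hpos : 0 < x ⬝ᵥ x := by simpa using dotProduct_star_self_pos_iff.2 hx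
  have h := hlow x
  rw [← dotProduct_self_eq_sum_sq] at h
  rw [star_trivial, dotProduct_comm]
  exact (mul_pos hc hpos).trans_le h

/-- The inverse of an elliptic matrix satisfies the same upper bound. -/
theorem Matrix.inv_mulVec_dotProduct_le [DecidableEq ι] {Λ : ℝ} (hΛ : 0 < Λ) (hdet : IsUnit A.det)
    (hlow : ∀ ξ : ι → ℝ, Λ⁻¹ * ∑ i, ξ i ^ 2 ≤ A *ᵥ ξ ⬝ᵥ ξ) (x : ι → ℝ) :
    A⁻¹ *ᵥ x ⬝ᵥ x ≤ Λ * ∑ i, x i ^ 2 := by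
  set y := A⁻¹ *ᵥ x with hy
  have hAy : A *ᵥ y = x := by rw [hy, mulVec_mulVec, mul_nonsing_inv _ hdet, one_mulVec]
  have h := hlow y
  rw [hAy, dotProduct_comm, ← dotProduct_self_eq_sum_sq] at h
  have hsq : 0 ≤ (y + (-Λ) • x) ⬝ᵥ (y + (-Λ) • x) := by
    simpa using dotProduct_star_self_nonneg (y + (-Λ) • x)
  simp only [add_dotProduct, dotProduct_add, smul_dotProduct, dotProduct_smul, smul_eq_mul,
    dotProduct_comm x y] at hsq
  rw [inv_mul_le_iff₀ hΛ] at h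
  rw [← dotProduct_self_eq_sum_sq]
  nlinarith

/-- The inverse of an elliptic matrix satisfies the same lower bound. -/
theorem Matrix.le_inv_mulVec_dotProduct [DecidableEq ι] {Λ : ℝ} (hΛ : 0 < Λ) (hA : A.IsSymm) (hpos : A.PosDef)
    (hup : ∀ ξ : ι → ℝ, A *ᵥ ξ ⬝ᵥ ξ ≤ Λ * ∑ i, ξ i ^ 2) (x : ι → ℝ) :
    Λ⁻¹ * ∑ i, x i ^ 2 ≤ A⁻¹ *ᵥ x ⬝ᵥ x := by
  set y := A⁻¹ *ᵥ x with hy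
  have hAy : A *ᵥ y = x := by
    rw [hy, mulVec_mulVec, mul_nonsing_inv _ hpos.det_pos.ne'.isUnit, one_mulVec]
  have h := hup x
  have hq : 0 ≤ A *ᵥ (y + (-Λ⁻¹) • x) ⬝ᵥ (y + (-Λ⁻¹) • x) := by
    rw [dotProduct_comm]
    simpa using hpos.posSemidef.dotProduct_mulVec_nonneg (y + (-Λ⁻¹) • x)
  rw [hA.mulVec_add_smul_dotProduct, hAy, dotProduct_comm x y] at hq
  rw [← dotProduct_self_eq_sum_sq] at h ⊢
  have h2 : Λ⁻¹ ^ 2 * (A *ᵥ x ⬝ᵥ x) ≤ Λ⁻¹ * (x ⬝ᵥ x) := by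
    calc Λ⁻¹ ^ 2 * (A *ᵥ x ⬝ᵥ x) ≤ Λ⁻¹ ^ 2 * (Λ * (x ⬝ᵥ x)) := by gcongr
      _ = Λ⁻¹ * (x ⬝ᵥ x) := by field_simp
  nlinarith

/-- A nonnegative quadratic form oscillates little around `e` on perturbations that are small
with respect to the form. -/
theorem Matrix.mulVec_add_dotProduct_mem_Icc {B : Matrix ι ι ℝ} (hB : B.IsSymm)
    (hnn : ∀ x : ι → ℝ, 0 ≤ B *ᵥ x ⬝ᵥ x) {ε : ℝ} (hε0 : 0 < ε) (hε1 : ε ≤ 1) {e w : ι → ℝ}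
    (hw : B *ᵥ w ⬝ᵥ w ≤ ε ^ 2 * (B *ᵥ e ⬝ᵥ e)) :
    B *ᵥ (e + w) ⬝ᵥ (e + w) ∈
      Set.Icc ((1 - 2 * ε) * (B *ᵥ e ⬝ᵥ e)) ((1 + 3 * ε) * (B *ᵥ e ⬝ᵥ e)) := by
  have hsum := hB.mulVec_add_smul_dotProduct e w 1
  have hp := hnn (w + ε • e)
  have hm := hnn (w + (-ε) • e)
  rw [hB.mulVec_add_smul_dotProduct, hB.mulVec_dotProduct_comm w e] at hp hm
  rw [one_smul] at hsum
  rw [hsum]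
  have he := hnn e
  have hw0 := hnn w
  generalize B *ᵥ e ⬝ᵥ e = a at *
  generalize B *ᵥ w ⬝ᵥ w = b at *
  generalize B *ᵥ e ⬝ᵥ w = c at *
  have h1 : -(ε * a) ≤ c := by
    refine le_of_mul_le_mul_left ?_ hε0
    nlinarith
  have h2 : c ≤ ε * a := by
    refine le_of_mul_le_mul_left ?_ hε0
    nlinarith
  have h3 : ε ^ 2 * a ≤ ε * a := by
    have : ε ^ 2 ≤ ε := by nlinarith
    gcongr
  constructor <;> nlinarith

end QuadraticForm

theorem Fin.snoc_neg_eq_single_add {n : ℕ} (z : Fin n → ℝ) :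
    (Fin.snoc (fun i => -z i) (1 : ℝ) : Fin (n + 1) → ℝ) =
      Pi.single (Fin.last n) 1 + Fin.snoc (fun i => -z i) (0 : ℝ) := by
  ext i
  refine Fin.lastCases ?_ (fun j => ?_) i <;> simp [Fin.castSucc_ne_last]

/-- If `f` takes values in `[m, M]` with `M ≤ (1 + β) m` on `s`, its averages satisfy the reverse
Hölder inequality with constant `1 + β`. -/
theorem MeasureTheory.sqrt_setAverage_sq_le {α : Type*} [MeasurableSpace α] {μ : Measure α}
    {s : Set α} (hs : MeasurableSet s) (h0 : μ s ≠ 0) (htop : μ s ≠ ⊤) {f : α → ℝ}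
    (hf : Measurable f) {m M β : ℝ} (hm : 0 ≤ m) (hβ : 0 ≤ β) (hM : M ≤ (1 + β) * m)
    (hmem : ∀ x ∈ s, f x ∈ Set.Icc m M) :
    Real.sqrt (⨍ x in s, f x ^ 2 ∂μ) ≤ (1 + β) * ⨍ x in s, f x ∂μ := by
  have hfin : Fact (μ s < ⊤) := ⟨htop.lt_top⟩
  obtain ⟨x₀, hx₀⟩ := nonempty_of_measure_ne_zero h0
  have hM0 : 0 ≤ M := hm.trans ((hmem x₀ hx₀).1.trans (hmem x₀ hx₀).2)
  have hae : ∀ᵐ x ∂μ.restrict s, f x ∈ Set.Icc m M := ae_restrict_of_forall_mem hs hmem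
  have hae2 : ∀ᵐ x ∂μ.restrict s, f x ^ 2 ∈ Set.Icc 0 (M ^ 2) := by
    filter_upwards [hae] with x hx
    exact ⟨sq_nonneg _, pow_le_pow_left₀ (hm.trans hx.1) hx.2 2⟩
  have hint : IntegrableOn f s μ := by
    refine Integrable.of_bound hf.aestronglyMeasurable M ?_
    filter_upwards [hae] with x hx
    rw [Real.norm_of_nonneg (hm.trans hx.1)]
    exact hx.2
  have hint2 : IntegrableOn (fun x => f x ^ 2) s μ := by
    refine Integrable.of_bound (hf.pow_const 2).aestronglyMeasurable (M ^ 2) ?_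
    filter_upwards [hae2] with x hx
    rw [Real.norm_of_nonneg hx.1]
    exact hx.2
  have h1 := Convex.set_average_mem (convex_Icc m M) isClosed_Icc h0 htop hae hint
  have h2 := Convex.set_average_mem (convex_Icc 0 (M ^ 2)) isClosed_Icc h0 htop hae2 hint2
  calc Real.sqrt (⨍ x in s, f x ^ 2 ∂μ) ≤ M := (Real.sqrt_le_left hM0).2 h2.2
    _ ≤ (1 + β) * m := hM
    _ ≤ (1 + β) * ⨍ x in s, f x ∂μ := by gcongr; exact h1.1

theorem measurable_poissonKernelConst (n : ℕ) (A₀ : Matrix (Fin (n + 1)) (Fin (n + 1)) ℝ) :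
    Measurable (poissonKernelConst n A₀) := by
  have hv : Continuous fun z : Fin n → ℝ =>
      (Fin.snoc (fun i => -z i) (1 : ℝ) : Fin (n + 1) → ℝ) := by
    refine continuous_pi fun i => ?_
    refine Fin.lastCases ?_ (fun j => ?_) i
    · simpa using continuous_const
    · simp only [Fin.snoc_castSucc]
      fun_prop
  have hq := (Continuous.matrix_mulVec (continuous_const (y := A₀⁻¹)) hv).dotProduct hv
  exact (hq.measurable.pow_const _).const_mul _

theorem euclideanBall_eq_preimage (n : ℕ) (δ : ℝ) :
    {z : Fin n → ℝ | Real.sqrt (∑ i, z i ^ 2) < δ} =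
      (WithLp.toLp 2 : (Fin n → ℝ) → EuclideanSpace ℝ (Fin n)) ⁻¹' Metric.ball 0 δ := by
  ext z
  simp [EuclideanSpace.norm_eq]

theorem volume_euclideanBall (n : ℕ) (δ : ℝ) :
    volume {z : Fin n → ℝ | Real.sqrt (∑ i, z i ^ 2) < δ} =
      volume (Metric.ball (0 : EuclideanSpace ℝ (Fin n)) δ) := by
  rw [euclideanBall_eq_preimage]
  exact (PiLp.volume_preserving_toLp (Fin n)).measure_preimage
    measurableSet_ball.nullMeasurableSet

/-- There is a relative oscillation `ε` that changes a power `-p` by a factor at most `1 + β`. -/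
theorem exists_rpow_neg_ratio_le (p : ℝ) {β : ℝ} (hβ : 0 < β) :
    ∃ ε : ℝ, 0 < ε ∧ ε < 1 / 2 ∧ (1 - 2 * ε) ^ (-p) ≤ (1 + β) * (1 + 3 * ε) ^ (-p) := by
  have hcont : ContinuousAt
      (fun ε : ℝ => (1 + β) * (1 + 3 * ε) ^ (-p) - (1 - 2 * ε) ^ (-p)) 0 := by
    refine ContinuousAt.sub (ContinuousAt.mul continuousAt_const ?_) ?_ <;>
    exact ContinuousAt.rpow_const (by fun_prop) (by norm_num)
  have hev := (hcont.eventually (lt_mem_nhds (show (0 : ℝ) < _ by simpa using hβ)))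
  have hev' := hev.and (gt_mem_nhds (show (0 : ℝ) < 1 / 2 by norm_num))
  obtain ⟨ε, ⟨h1, h2⟩, h3⟩ :=
    ((hev'.filter_mono nhdsWithin_le_nhds).and (self_mem_nhdsWithin (s := Set.Ioi 0))).exists
  exact ⟨ε, h3, h2, (sub_pos.1 h1).le⟩

/-- Lemma 3.7: for every `β ∈ (0,1)` there is `δ₁ = δ₁(β,n,Λ) > 0`,
uniform over all real symmetric `Λ`-elliptic constant matrices `A₀`, such that
`(⨍_{B(0,δ)} K_{A₀}²)^{1/2} ≤ (1+β) ⨍_{B(0,δ)} K_{A₀}` for all `δ ∈ (0, δ₁)`. -/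
theorem poisson_kernel_optimal_B2_small_scales (n : ℕ) (hn : 2 ≤ n) (Λ : ℝ) (hΛ : 1 ≤ Λ)
    (β : ℝ) (hβ0 : 0 < β) (hβ1 : β < 1) :
    ∃ δ₁ : ℝ, 0 < δ₁ ∧
      ∀ A₀ : Matrix (Fin (n + 1)) (Fin (n + 1)) ℝ, A₀.IsSymm →
        (∀ ξ : Fin (n + 1) → ℝ, Λ⁻¹ * ∑ i, ξ i ^ 2 ≤ dotProduct (A₀.mulVec ξ) ξ) →
        (∀ ξ : Fin (n + 1) → ℝ, dotProduct (A₀.mulVec ξ) ξ ≤ Λ * ∑ i, ξ i ^ 2) →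
      ∀ δ : ℝ, 0 < δ → δ < δ₁ →
        Real.sqrt (⨍ z in {z : Fin n → ℝ | Real.sqrt (∑ i, z i ^ 2) < δ},
            (poissonKernelConst n A₀ z) ^ 2) ≤
          (1 + β) * ⨍ z in {z : Fin n → ℝ | Real.sqrt (∑ i, z i ^ 2) < δ},
            poissonKernelConst n A₀ z := by
  obtain ⟨ε, hε0, hε1, hε⟩ := exists_rpow_neg_ratio_le (((n : ℝ) + 1) / 2) hβ0
  have hΛ0 : 0 < Λ := by linarith
  refine ⟨ε / Λ, by positivity, fun A hA hlow hup δ hδ hδ₁ => ?_⟩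
  have hpd := posDef_of_coercive (inv_pos.2 hΛ0) hA hlow
  have hdet : IsUnit A.det := hpd.det_pos.ne'.isUnit
  have hupI := inv_mulVec_dotProduct_le hΛ0 hdet hlow
  have hlowI := le_inv_mulVec_dotProduct hΛ0 hA hpd hup
  have hnn (x : Fin (n + 1) → ℝ) : 0 ≤ A⁻¹ *ᵥ x ⬝ᵥ x := le_trans (by positivity) (hlowI x)
  set e : Fin (n + 1) → ℝ := Pi.single (Fin.last n) 1 with he
  set a := A⁻¹ *ᵥ e ⬝ᵥ e with ha
  have haΛ : Λ⁻¹ ≤ a := by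
    have h := hlowI e
    rwa [← dotProduct_self_eq_sum_sq, he, single_dotProduct, Pi.single_eq_same, mul_one,
      mul_one] at h
  have ha0 : 0 < a := (inv_pos.2 hΛ0).trans_le haΛ
  set C := poissonConst n * A.det ^ (-(1 : ℝ) / 2) * Real.sqrt a with hC
  have hC0 : 0 ≤ C := by
    have : 0 < Real.Gamma (((n : ℝ) + 1) / 2) := Real.Gamma_pos_of_pos (by positivity)
    have := hpd.det_pos
    rw [hC, poissonConst]
    positivity
  set p : ℝ := ((n : ℝ) + 1) / 2 with hp
  have hp0 : -p ≤ 0 := by rw [hp]; simp only [Left.neg_nonpos_iff]; positivity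
  have h2ε : 0 < 1 - 2 * ε := by linarith
  have hvol := volume_euclideanBall n δ
  have hmeas : MeasurableSet {z : Fin n → ℝ | Real.sqrt (∑ i, z i ^ 2) < δ} :=
    (isOpen_lt (by fun_prop) continuous_const).measurableSet
  refine sqrt_setAverage_sq_le (m := C * ((1 + 3 * ε) * a) ^ (-p))
    (M := C * ((1 - 2 * ε) * a) ^ (-p)) hmeas
    (by rw [hvol]; exact (Metric.measure_ball_pos _ _ hδ).ne')
    (by rw [hvol]; exact measure_ball_lt_top.ne) (measurable_poissonKernelConst n A)
    (mul_nonneg hC0 (by positivity)) hβ0.le ?_ fun z hz => ?_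
  · rw [Real.mul_rpow h2ε.le ha0.le, Real.mul_rpow (by positivity) ha0.le]
    calc C * ((1 - 2 * ε) ^ (-p) * a ^ (-p))
        ≤ C * (((1 + β) * (1 + 3 * ε) ^ (-p)) * a ^ (-p)) := by gcongr
      _ = _ := by ring
  · have hzδ : ∑ i, z i ^ 2 ≤ δ ^ 2 := ((Real.sqrt_lt' hδ).1 hz).le
    have hw : A⁻¹ *ᵥ Fin.snoc (fun i => -z i) 0 ⬝ᵥ Fin.snoc (fun i => -z i) 0 ≤ ε ^ 2 * a := by
      calc _ ≤ Λ * ∑ i, (Fin.snoc (fun i => -z i) 0 : Fin (n + 1) → ℝ) i ^ 2 := hupI _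
        _ = Λ * ∑ i, z i ^ 2 := by simp [Fin.sum_univ_castSucc]
        _ ≤ Λ * (ε / Λ) ^ 2 := by
          gcongr
          exact hzδ.trans (by gcongr)
        _ = ε ^ 2 * Λ⁻¹ := by field_simp
        _ ≤ ε ^ 2 * a := by gcongr
    have hq := mulVec_add_dotProduct_mem_Icc hA.inv hnn hε0 (by linarith) hw
    rw [he, ← Fin.snoc_neg_eq_single_add, ← he, ← ha] at hq
    have hK : poissonKernelConst n A z = C * (A⁻¹ *ᵥ Fin.snoc (fun i => -z i) (1 : ℝ) ⬝ᵥ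
        Fin.snoc (fun i => -z i) (1 : ℝ)) ^ (-p) := by
      rw [hC, hp, ← neg_div]
      rfl
    have hq0 := (mul_pos h2ε ha0).trans_le hq.1
    rw [hK]
    constructor
    · gcongr C * ?_
      exact Real.rpow_le_rpow_of_nonpos hq0 hq.2 hp0
    · gcongr C * ?_
      exact Real.rpow_le_rpow_of_nonpos (mul_pos h2ε ha0) hq.1 hp0
end
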